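/- Let E₁ be a Banach space, 1 ≤ p < 2, X ∈ V^p([0,T],ℝ^n), f : E₁ → L(ℝ^n,E₁) γ-Hölder with 1 + γ > p, and set f_i(y) = f(y)(e_i) for the standard basis e_1,…,e_n of ℝ^n. Let Φ : E₁ → E₁ be a twice continuously differentiable map with DΦ(y)(f_i(y)) = f_i(Φ(y)) for all y ∈ E₁ and i = 1,…,n (i.e. Φ_* f_i = f_i). Then Φ is a symmetry of dY = Σ_i f_i(Y)dX^i: for every solution Y starting at y₀, Φ ∘ Y is a solution starting at Φ(y₀). -/

import Mathlib

open Set Filter Topology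

noncomputable section

/-- The `p`-variation of a path `X : ℝ → E` on the interval `[a,b]`,
`‖X‖_{p,[a,b]} = (sup_D Σ_i ‖X_{t_{i+1}} − X_{t_i}‖^p)^(1/p)`, the supremum being taken
over all finite partitions `a = t₀ ≤ t₁ ≤ … ≤ t_k = b`. -/
def pVar {E : Type*} [NormedAddCommGroup E] (p : ℝ) (X : ℝ → E) (a b : ℝ) : ENNReal :=
  ⨆ (k : ℕ) (t : Fin (k + 1) → ℝ)
    (_ : Monotone t ∧ t 0 = a ∧ t (Fin.last k) = b),
    (∑ i : Fin k, (‖X (t i.succ) - X (t i.castSucc)‖₊ : ENNReal) ^ p) ^ (1 / p)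

/-- `X ∈ V^p([a,b],E)`: `X` is continuous on `[a,b]` and has finite `p`-variation there. -/
def MemVp {E : Type*} [NormedAddCommGroup E] (p : ℝ) (X : ℝ → E) (a b : ℝ) : Prop :=
  ContinuousOn X (Set.Icc a b) ∧ pVar p X a b < ⊤

/-- A partition `a = t₀ ≤ t₁ ≤ … ≤ t_k = b` of `[a,b]`. -/
structure YoungPartition (a b : ℝ) where
  k : ℕ
  t : Fin (k + 1) → ℝ
  mono : Monotone t
  first : t 0 = a
  last : t (Fin.last k) = b

/-- The mesh of a partition. -/
def YoungPartition.mesh {a b : ℝ} (D : YoungPartition a b) : ℝ :=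
  ⨆ i : Fin D.k, (D.t i.succ - D.t i.castSucc)

/-- The Riemann sum `Σ_i Z_{t_i}(X_{t_{i+1}} − X_{t_i})` along a partition. -/
def riemannSum {E F : Type*} [NormedAddCommGroup E] [NormedSpace ℝ E]
    [NormedAddCommGroup F] [NormedSpace ℝ F]
    (Z : ℝ → E →L[ℝ] F) (X : ℝ → E) {a b : ℝ} (D : YoungPartition a b) : F :=
  ∑ i : Fin D.k, Z (D.t i.castSucc) (X (D.t i.succ) - X (D.t i.castSucc))

/-- `IsYoungIntegral Z X a b I` : the Riemann sums of `Z` against `X` over partitions of `[a,b]`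
converge to `I` as the mesh tends to `0`; i.e. the Young integral `∫_a^b Z dX` exists and
equals `I`. -/
def IsYoungIntegral {E F : Type*} [NormedAddCommGroup E] [NormedSpace ℝ E]
    [NormedAddCommGroup F] [NormedSpace ℝ F]
    (Z : ℝ → E →L[ℝ] F) (X : ℝ → E) (a b : ℝ) (I : F) : Prop :=
  Filter.Tendsto (fun D : YoungPartition a b => riemannSum Z X D)
    (Filter.comap YoungPartition.mesh (nhds 0)) (nhds I)

/-- View a vector `v : E` as the continuous linear map `ℝ →L[ℝ] E`, `c ↦ c • v`; used to
integrate vector-valued integrands against scalar integrators. -/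
def toCLM {E : Type*} [NormedAddCommGroup E] [NormedSpace ℝ E] (v : E) : ℝ →L[ℝ] E :=
  (1 : ℝ →L[ℝ] ℝ).smulRight v

/-- The `α`-Hölder seminorm `‖X‖_{α;H} = sup_{s ≠ t ∈ [a,b]} ‖X_t − X_s‖ / |t−s|^α` of a path. -/
def holderSemiPath {E : Type*} [NormedAddCommGroup E] (α : ℝ) (X : ℝ → E) (a b : ℝ) : ENNReal :=
  ⨆ (s : Set.Icc a b) (t : Set.Icc a b) (_ : (s : ℝ) ≠ (t : ℝ)),
    (‖X (t : ℝ) - X (s : ℝ)‖₊ : ENNReal) / edist (s : ℝ) (t : ℝ) ^ α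

/-- The `α`-Hölder norm (sup norm plus Hölder seminorm) of a path on `[a,b]`. -/
def holderNormPath {E : Type*} [NormedAddCommGroup E] (α : ℝ) (X : ℝ → E) (a b : ℝ) : ENNReal :=
  (⨆ t : Set.Icc a b, (‖X (t : ℝ)‖₊ : ENNReal)) + holderSemiPath α X a b

/-- The `γ`-Hölder constant `‖f‖_{γ,H} = sup_{x ≠ y} ‖f x − f y‖ / ‖x − y‖^γ` of a map
between normed spaces. -/
def holderConst {E F : Type*} [NormedAddCommGroup E] [NormedAddCommGroup F]
    (γ : ℝ) (f : E → F) : ENNReal :=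
  ⨆ (x : E) (y : E) (_ : x ≠ y), (‖f x - f y‖₊ : ENNReal) / (‖x - y‖₊ : ENNReal) ^ γ
/-- `Y` is a solution on `[0,T]` of the Young equation `dY = Σ_{i=1}^n f_i(Y) dX^i`
starting at `y₀`, where `f_i(y) = f(y)(e_i)` for the standard basis `e_i` of `ℝ^n` and
`X^i` are the coordinates of `X`: `Y ∈ V^p([0,T],E₁)` and
`Y_t = y₀ + Σ_i ∫_0^t f_i(Y_s) dX^i_s` (Young integrals). -/
def IsYoungSolution {n : ℕ} {E₁ : Type*} [NormedAddCommGroup E₁] [NormedSpace ℝ E₁]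
    (p T : ℝ) (X : ℝ → Fin n → ℝ) (f : E₁ → (Fin n → ℝ) →L[ℝ] E₁)
    (y₀ : E₁) (Y : ℝ → E₁) : Prop :=
  Y 0 = y₀ ∧ MemVp p Y 0 T ∧
  ∀ t ∈ Set.Icc (0 : ℝ) T, ∃ I : Fin n → E₁,
    (∀ i, IsYoungIntegral (fun s => toCLM (f (Y s) (Pi.single i 1)))
      (fun s => X s i) 0 t (I i)) ∧
    Y t = y₀ + ∑ i, I i

section Chain

variable {F : Type*} [NormedAddCommGroup F]

/-- The sum of the two-parameter function `Ξ` over the consecutive points of `x, l, y`. -/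
def chainSum (Ξ : ℝ → ℝ → F) : ℝ → List ℝ → ℝ → F
  | x, [], y => Ξ x y
  | x, u :: l, y => Ξ x u + chainSum Ξ u l y

/-- Consecutive points of `x, l, y` increase by at most `δ`. -/
def ChainFine (δ : ℝ) : ℝ → List ℝ → ℝ → Prop
  | x, [], y => x ≤ y ∧ y - x ≤ δ
  | x, u :: l, y => (x ≤ u ∧ u - x ≤ δ) ∧ ChainFine δ u l y

theorem chainSum_append (Ξ : ℝ → ℝ → F) (x u y : ℝ) (l₁ l₂ : List ℝ) :
    chainSum Ξ x (l₁ ++ u :: l₂) y = chainSum Ξ x l₁ u + chainSum Ξ u l₂ y := by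
  induction l₁ generalizing x with
  | nil => rfl
  | cons w l ih => simp [chainSum, ih, add_assoc]

theorem chainSum_ofFn (Ξ : ℝ → ℝ → F) (k : ℕ) (t : Fin (k + 1) → ℝ) (x y : ℝ) :
    chainSum Ξ x (List.ofFn t) y =
      Ξ x (t 0) + ∑ i : Fin k, Ξ (t i.castSucc) (t i.succ) + Ξ (t (Fin.last k)) y := by
  induction k generalizing x with
  | zero => simp [chainSum]
  | succ k ih =>
    rw [List.ofFn_succ, chainSum, ih (fun i => t i.succ), Fin.sum_univ_succ]
    simp only [Fin.succ_zero_eq_one, Fin.succ_last, Fin.castSucc_zero, Fin.succ_castSucc]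
    abel

theorem chainFine_ofFn {δ : ℝ} (k : ℕ) (t : Fin (k + 1) → ℝ) (x y : ℝ)
    (hx : x ≤ t 0 ∧ t 0 - x ≤ δ) (hy : t (Fin.last k) ≤ y ∧ y - t (Fin.last k) ≤ δ)
    (ht : ∀ i : Fin k, t i.castSucc ≤ t i.succ ∧ t i.succ - t i.castSucc ≤ δ) :
    ChainFine δ x (List.ofFn t) y := by
  induction k generalizing x with
  | zero => exact ⟨hx, hy⟩
  | succ k ih =>
    rw [List.ofFn_succ, ChainFine]
    refine ⟨hx, ih (fun i => t i.succ) _ (by simpa using ht 0) (by simpa using hy) fun i => ?_⟩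
    simpa using ht i.succ

theorem exists_chainFine {δ : ℝ} (hδ : 0 < δ) {x y : ℝ} (hxy : x ≤ y) :
    ∃ l : List ℝ, ChainFine δ x l y := by
  obtain ⟨N, hN⟩ := exists_nat_ge ((y - x) / δ)
  rw [div_le_iff₀ hδ] at hN
  induction N generalizing x with
  | zero => exact ⟨[], hxy, by simp at hN; linarith⟩
  | succ N ih =>
    rcases le_total y (x + δ) with h | h
    · exact ⟨[], hxy, by linarith⟩
    · obtain ⟨l, hl⟩ := ih h (by push_cast at hN; linarith)
      exact ⟨(x + δ) :: l, ⟨by linarith, by linarith⟩, hl⟩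

theorem ChainFine.pairwise {δ x y : ℝ} {l : List ℝ} (h : ChainFine δ x l y) :
    x ≤ y ∧ l.Pairwise (· ≤ ·) ∧ ∀ z ∈ l, z ∈ Icc x y := by
  induction l generalizing x with
  | nil => exact ⟨h.1, by simp, by simp⟩
  | cons u l ih =>
    obtain ⟨h1, h2, h3⟩ := ih h.2
    refine ⟨h.1.1.trans h1, List.pairwise_cons.2 ⟨fun z hz => (h3 z hz).1, h2⟩, ?_⟩
    intro z hz
    rcases List.mem_cons.1 hz with rfl | hz
    · exact ⟨h.1.1, h1⟩
    · exact ⟨h.1.1.trans (h3 z hz).1, (h3 z hz).2⟩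

/-- On subintervals of `[a,b]`, the defect of additivity of `Ξ` is at most `ε` times the power `θ`
of the increment of `v`. -/
def DefectLE (Ξ : ℝ → ℝ → F) (v : ℝ → ℝ) (θ ε a b : ℝ) : Prop :=
  ∀ s u t, a ≤ s → s ≤ u → u ≤ t → t ≤ b → ‖Ξ s t - (Ξ s u + Ξ u t)‖ ≤ ε * (v t - v s) ^ θ

/-- The constant of the maximal inequality for almost additive functions. -/
def sewingConst (θ : ℝ) : ℝ := 2 / (1 - 2 * (1 / 2 : ℝ) ^ θ)

theorem two_mul_half_rpow_lt_one {θ : ℝ} (hθ : 1 < θ) : 2 * (1 / 2 : ℝ) ^ θ < 1 := by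
  have : (1 / 2 : ℝ) ^ θ < (1 / 2 : ℝ) ^ (1 : ℝ) :=
    Real.rpow_lt_rpow_of_exponent_gt (by norm_num) (by norm_num) hθ
  rw [Real.rpow_one] at this
  linarith

theorem sewingConst_pos {θ : ℝ} (hθ : 1 < θ) : 0 < sewingConst θ :=
  div_pos two_pos (by linarith [two_mul_half_rpow_lt_one hθ])

theorem sewingConst_eq {θ : ℝ} (hθ : 1 < θ) :
    2 * (1 / 2 : ℝ) ^ θ * sewingConst θ + 2 = sewingConst θ := by
  have : 1 - 2 * (1 / 2 : ℝ) ^ θ ≠ 0 := by linarith [two_mul_half_rpow_lt_one hθ]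
  unfold sewingConst
  field_simp
  ring

/-- The maximal inequality behind the sewing lemma. -/
theorem norm_chainSum_sub_le {Ξ : ℝ → ℝ → F} {v : ℝ → ℝ} {θ ε a b : ℝ} (hθ : 1 < θ)
    (hε : 0 ≤ ε) (hv : MonotoneOn v (Icc a b)) (hΞ : DefectLE Ξ v θ ε a b) {x y : ℝ}
    {l : List ℝ} (hx : a ≤ x) (hxy : x ≤ y) (hy : y ≤ b) (hl : l.Pairwise (· ≤ ·))
    (hmem : ∀ z ∈ l, z ∈ Icc x y) :
    ‖chainSum Ξ x l y - Ξ x y‖ ≤ ε * sewingConst θ * (v y - v x) ^ θ := by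
  have hK := (sewingConst_pos hθ).le
  induction hn : l.length using Nat.strong_induction_on generalizing l x y with
  | _ n ih =>
  subst hn
  set w := v y - v x with hw
  have hw0 : 0 ≤ w := sub_nonneg.2 (hv ⟨hx, hxy.trans hy⟩ ⟨hx.trans hxy, hy⟩ hxy)
  have hhalf : ∀ r : ℝ, 0 ≤ r → r ≤ w / 2 →
      ε * sewingConst θ * r ^ θ ≤ ε * sewingConst θ * ((1 / 2) ^ θ * w ^ θ) := by
    intro r hr hrw
    rw [← Real.mul_rpow (by norm_num) hw0]
    gcongr
    linarith
  have hfin : 2 * (ε * sewingConst θ * ((1 / 2) ^ θ * w ^ θ)) + 2 * (ε * w ^ θ) =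
      ε * sewingConst θ * w ^ θ := by
    linear_combination (ε * w ^ θ) * sewingConst_eq hθ
  -- the part of the chain within half of the total increment of `v`
  have left : ∀ (l₁ : List ℝ) (u : ℝ), l₁.length ≤ l.length → l₁.Pairwise (· ≤ ·) →
      x ≤ u → u ≤ y → (∀ z ∈ l₁, z ∈ Icc x u) → (∀ z ∈ l₁, v z - v x ≤ w / 2) →
      ‖chainSum Ξ x l₁ u - Ξ x u‖ ≤
        ε * sewingConst θ * ((1 / 2) ^ θ * w ^ θ) + ε * w ^ θ := by
    intro l₁ u hlen hs hxu huy hm hg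
    rcases List.eq_nil_or_concat l₁ with rfl | ⟨l₀, c, rfl⟩
    · simp only [chainSum, sub_self, norm_zero]
      positivity
    · rw [List.concat_eq_append] at *
      have hc := hm c (by simp)
      rw [List.pairwise_append] at hs
      have hvc := hv ⟨hx, hxy.trans hy⟩ ⟨hx.trans hc.1, hc.2.trans (huy.trans hy)⟩ hc.1
      have h1 := ih l₀.length (by simp at hlen; omega) (x := x) (y := c) (l := l₀) hx hc.1
        (hc.2.trans (huy.trans hy)) hs.1
        (fun z hz => ⟨(hm z (by simp [hz])).1, hs.2.2 z hz c (by simp)⟩) rfl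
      have h2 := hΞ x c u hx hc.1 hc.2 (huy.trans hy)
      have h3 : (v u - v x) ^ θ ≤ w ^ θ := by
        have := hv ⟨hx, hxy.trans hy⟩ ⟨hx.trans hxu, huy.trans hy⟩ hxu
        have := hv ⟨hx.trans hxu, huy.trans hy⟩ ⟨hx.trans hxy, hy⟩ huy
        apply Real.rpow_le_rpow <;> linarith
      rw [chainSum_append]
      calc _ = ‖(chainSum Ξ x l₀ c - Ξ x c) - (Ξ x u - (Ξ x c + Ξ c u))‖ := by
            simp only [chainSum]; congr 1; abel
        _ ≤ _ := norm_sub_le _ _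
        _ ≤ _ := add_le_add (h1.trans (hhalf _ (by linarith) (hg c (by simp))))
            (h2.trans (by gcongr))
  classical
  set P : ℝ → Bool := fun z => decide (v z - v x ≤ w / 2) with hP
  have hsplit : l.takeWhile P ++ l.dropWhile P = l := List.takeWhile_append_dropWhile
  have hgood : ∀ z ∈ l.takeWhile P, v z - v x ≤ w / 2 := by
    intro z hz
    simpa [hP] using List.mem_takeWhile_imp hz
  have hbad := @List.head_dropWhile_not _ P l
  generalize l.takeWhile P = l₁ at hsplit hgood
  generalize l.dropWhile P = l₂ at hsplit hbad
  rcases l₂ with _ | ⟨u, l₂⟩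
  · rw [List.append_nil] at hsplit
    subst hsplit
    have := left l₁ y le_rfl hl hxy le_rfl hmem hgood
    have : 0 ≤ ε * sewingConst θ * ((1 / 2) ^ θ * w ^ θ) := by positivity
    have : 0 ≤ ε * w ^ θ := by positivity
    linarith
  · have hu : w / 2 < v u - v x := by
      have := hbad (by simp)
      simp only [hP, List.head_cons, decide_eq_false_iff_not, not_le] at this
      exact this
    subst hsplit
    have hum := hmem u (by simp)
    have hub := hum.2.trans hy
    rw [List.pairwise_append, List.pairwise_cons] at hl
    have h1 := left l₁ u (by simp) hl.1 hum.1 hum.2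
      (fun z hz => ⟨(hmem z (by simp [hz])).1, hl.2.2 z hz u (by simp)⟩) hgood
    have h2 := ih l₂.length (by simp; omega) (x := u) (y := y) (l := l₂) (hx.trans hum.1) hum.2
      hy hl.2.1.2 (fun z hz => ⟨hl.2.1.1 z hz, (hmem z (by simp [hz])).2⟩) rfl
    have h3 := hΞ x u y hx hum.1 hum.2 hy
    have h4 := hv ⟨hx.trans hum.1, hub⟩ ⟨hx.trans hxy, hy⟩ hum.2
    rw [chainSum_append]
    calc _ = ‖(chainSum Ξ x l₁ u - Ξ x u) + (chainSum Ξ u l₂ y - Ξ u y)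
            - (Ξ x y - (Ξ x u + Ξ u y))‖ := by congr 1; abel
      _ ≤ _ := (norm_sub_le _ _).trans (add_le_add_left (norm_add_le _ _) _)
      _ ≤ _ := add_le_add (add_le_add h1 (h2.trans (hhalf _ (by linarith) (by linarith)))) h3
      _ = _ := by rw [← hfin]; ring

/-- Refining a fine chain changes its sum by a small amount. -/
theorem norm_chainSum_sub_chainSum_le {Ξ : ℝ → ℝ → F} {v : ℝ → ℝ} {θ ε δ a b : ℝ} (hθ : 1 < θ)
    (hε : 0 ≤ ε) (hv : MonotoneOn v (Icc a b))
    (hΞ : ∀ x y, a ≤ x → x ≤ y → y ≤ b → y - x ≤ δ → DefectLE Ξ v θ ε x y) {x y : ℝ}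
    {l m : List ℝ} (hx : a ≤ x) (hy : y ≤ b) (hl : ChainFine δ x l y)
    (hlm : l.Sublist m) (hm : m.Pairwise (· ≤ ·)) (hmem : ∀ z ∈ m, z ∈ Icc x y) :
    ‖chainSum Ξ x m y - chainSum Ξ x l y‖ ≤ ε * sewingConst θ * (v y - v x) ^ θ := by
  have hK := (sewingConst_pos hθ).le
  induction l generalizing x m with
  | nil =>
    exact norm_chainSum_sub_le hθ hε (hv.mono (Icc_subset_Icc hx hy))
      (hΞ x y hx hl.1 hy hl.2) le_rfl hl.1 le_rfl hm hmem
  | cons u l ih =>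
    obtain ⟨m₁, m₂, rfl, hu, hlm'⟩ := List.cons_sublist_iff.1 hlm
    obtain ⟨r, s, rfl⟩ := List.append_of_mem hu
    rw [List.append_assoc, List.cons_append] at hm hmem ⊢
    have hum := hmem u (by simp)
    rw [List.pairwise_append, List.pairwise_cons] at hm
    have h1 := norm_chainSum_sub_le hθ hε (hv.mono (Icc_subset_Icc hx (hum.2.trans hy)))
      (hΞ x u hx hum.1 (hum.2.trans hy) hl.1.2) le_rfl hum.1 le_rfl hm.1
      (fun z hz => ⟨(hmem z (by simp [hz])).1, hm.2.2 z hz u (by simp)⟩)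
    have h2 := ih (x := u) (m := s ++ m₂) (hx.trans hum.1) hl.2
      (hlm'.trans (List.sublist_append_right _ _)) hm.2.1.2
      (fun z hz => ⟨hm.2.1.1 z hz, (hmem z (by simp_all)).2⟩)
    have h3 := hv ⟨hx, hum.1.trans (hum.2.trans hy)⟩ ⟨hx.trans hum.1, hum.2.trans hy⟩ hum.1
    have h4 := hv ⟨hx.trans hum.1, hum.2.trans hy⟩ ⟨hx.trans (hum.1.trans hum.2), hy⟩ hum.2
    have h5 := Real.add_rpow_le_rpow_add (sub_nonneg.2 h3) (sub_nonneg.2 h4) hθ.le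
    rw [chainSum_append, chainSum]
    calc _ = ‖(chainSum Ξ x r u - Ξ x u) + (chainSum Ξ u (s ++ m₂) y - chainSum Ξ u l y)‖ := by
          congr 1; abel
      _ ≤ _ := norm_add_le _ _
      _ ≤ _ := add_le_add h1 h2
      _ = ε * sewingConst θ * ((v u - v x) ^ θ + (v y - v u) ^ θ) := by ring
      _ ≤ _ := by
        gcongr
        exact h5.trans_eq (by ring_nf)

end Chain

namespace YoungPartition

variable {F : Type*} [NormedAddCommGroup F] {a b : ℝ}

/-- The sum of the two-parameter function `Ξ` over the intervals of a partition. -/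
def sum (Ξ : ℝ → ℝ → F) (D : YoungPartition a b) : F :=
  ∑ i : Fin D.k, Ξ (D.t i.castSucc) (D.t i.succ)

/-- All intervals of the partition have length at most `δ`. -/
def Fine (δ : ℝ) (D : YoungPartition a b) : Prop :=
  ∀ i : Fin D.k, D.t i.succ - D.t i.castSucc ≤ δ

theorem step_le (D : YoungPartition a b) (i : Fin D.k) : D.t i.castSucc ≤ D.t i.succ :=
  D.mono (Fin.castSucc_lt_succ).le

theorem mem_Icc (D : YoungPartition a b) (i : Fin (D.k + 1)) : D.t i ∈ Icc a b :=
  ⟨D.first.symm.le.trans (D.mono (Fin.zero_le i)), (D.mono (Fin.le_last i)).trans D.last.le⟩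

theorem mesh_nonneg (D : YoungPartition a b) : 0 ≤ D.mesh :=
  Real.iSup_nonneg fun i => sub_nonneg.2 (D.step_le i)

theorem mesh_le_iff {δ : ℝ} (hδ : 0 ≤ δ) (D : YoungPartition a b) : D.mesh ≤ δ ↔ D.Fine δ :=
  ⟨fun h i => (le_ciSup (f := fun i : Fin D.k => D.t i.succ - D.t i.castSucc)
    (Set.finite_range _).bddAbove i).trans h, fun h => Real.iSup_le h hδ⟩

/-- The partition with one point. -/
def single (a : ℝ) : YoungPartition a a := ⟨0, fun _ => a, fun _ _ _ => le_rfl, rfl, rfl⟩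

/-- Append a point to a partition. -/
def snoc (D : YoungPartition a b) {c : ℝ} (h : b ≤ c) : YoungPartition a c where
  k := D.k + 1
  t := Fin.snoc (α := fun _ => ℝ) D.t c
  mono := by
    rw [Fin.monotone_iff_le_succ]
    intro i
    refine Fin.lastCases ?_ (fun i => ?_) i
    · rw [Fin.snoc_castSucc, Fin.succ_last, Fin.snoc_last, D.last]
      exact h
    · rw [Fin.snoc_castSucc, Fin.succ_castSucc, Fin.snoc_castSucc]
      exact D.step_le i
  first := by
    rw [← Fin.castSucc_zero, Fin.snoc_castSucc, D.first]
  last := Fin.snoc_last _ _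

theorem sum_snoc (Ξ : ℝ → ℝ → F) (D : YoungPartition a b) {c : ℝ} (h : b ≤ c) :
    (D.snoc h).sum Ξ = D.sum Ξ + Ξ b c := by
  change ∑ i : Fin (D.k + 1), Ξ (Fin.snoc (α := fun _ => ℝ) D.t c i.castSucc)
    (Fin.snoc (α := fun _ => ℝ) D.t c i.succ) = _
  rw [Fin.sum_univ_castSucc]
  simp only [Fin.snoc_castSucc, Fin.succ_castSucc, Fin.succ_last, Fin.snoc_last, D.last, sum]

theorem Fine.snoc {δ : ℝ} {D : YoungPartition a b} (hD : D.Fine δ) {c : ℝ} (h : b ≤ c)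
    (hc : c - b ≤ δ) : (D.snoc h).Fine δ := by
  intro i
  simp only [YoungPartition.snoc] at i ⊢
  refine Fin.lastCases ?_ (fun i => ?_) i
  · rwa [Fin.snoc_castSucc, Fin.succ_last, Fin.snoc_last, D.last]
  · rw [Fin.snoc_castSucc, Fin.succ_castSucc, Fin.snoc_castSucc]
    exact hD i

theorem exists_append {δ : ℝ} (Ξ : ℝ → ℝ → F) (D : YoungPartition a b) (hD : D.Fine δ)
    {l : List ℝ} {c : ℝ} (hl : ChainFine δ b l c) :
    ∃ D' : YoungPartition a c, D'.Fine δ ∧ D'.sum Ξ = D.sum Ξ + chainSum Ξ b l c := by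
  induction l generalizing b with
  | nil => exact ⟨D.snoc hl.1, hD.snoc hl.1 hl.2, D.sum_snoc Ξ hl.1⟩
  | cons u l ih =>
    obtain ⟨D', h1, h2⟩ := ih (D.snoc hl.1.1) (hD.snoc hl.1.1 hl.1.2) hl.2
    exact ⟨D', h1, by rw [h2, sum_snoc, chainSum, add_assoc]⟩

theorem exists_fine {δ : ℝ} (hδ : 0 < δ) (hab : a ≤ b) : ∃ D : YoungPartition a b, D.Fine δ := by
  obtain ⟨l, hl⟩ := exists_chainFine hδ hab
  obtain ⟨D, hD, -⟩ := (single a).exists_append (fun _ _ => (0 : ℝ)) (fun i => i.elim0) hl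
  exact ⟨D, hD⟩

theorem neBot (hab : a ≤ b) : (comap (mesh : YoungPartition a b → ℝ) (𝓝 0)).NeBot := by
  rw [comap_neBot_iff]
  intro s hs
  obtain ⟨ε, hε, hs⟩ := Metric.mem_nhds_iff.1 hs
  obtain ⟨D, hD⟩ := exists_fine (half_pos hε) hab
  refine ⟨D, hs ?_⟩
  rw [mem_ball_zero_iff, Real.norm_of_nonneg D.mesh_nonneg]
  exact ((D.mesh_le_iff (half_pos hε).le).2 hD).trans_lt (half_lt_self hε)

theorem eventually_fine {δ : ℝ} (hδ : 0 < δ) :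
    ∀ᶠ D : YoungPartition a b in comap mesh (𝓝 0), D.Fine δ := by
  filter_upwards [tendsto_comap.eventually (Iic_mem_nhds hδ)] with D hD
  exact (D.mesh_le_iff hδ.le).1 hD

theorem chainSum_ofFn_eq {Ξ : ℝ → ℝ → F} (hΞ : ∀ s, Ξ s s = 0) (D : YoungPartition a b) :
    chainSum Ξ a (List.ofFn D.t) b = D.sum Ξ := by
  rw [chainSum_ofFn, D.first, D.last, hΞ, hΞ, zero_add, add_zero, sum]

theorem Fine.chainFine {δ : ℝ} (hδ : 0 ≤ δ) {D : YoungPartition a b} (hD : D.Fine δ) :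
    ChainFine δ a (List.ofFn D.t) b :=
  chainFine_ofFn _ _ _ _ (by simpa [D.first] using hδ) (by simpa [D.last] using hδ)
    fun i => ⟨D.step_le i, hD i⟩

theorem norm_sum_sub_sum_le {Ξ : ℝ → ℝ → F} {v : ℝ → ℝ} {θ ε δ : ℝ} (hθ : 1 < θ)
    (hε : 0 ≤ ε) (hδ : 0 ≤ δ) (hv : MonotoneOn v (Icc a b)) (h0 : ∀ s, Ξ s s = 0)
    (hΞ : ∀ x y, a ≤ x → x ≤ y → y ≤ b → y - x ≤ δ → DefectLE Ξ v θ ε x y)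
    {D D' : YoungPartition a b} (hD : D.Fine δ) (hD' : D'.Fine δ) :
    ‖D.sum Ξ - D'.sum Ξ‖ ≤ 2 * (ε * sewingConst θ * (v b - v a) ^ θ) := by
  have c := hD.chainFine hδ
  have c' := hD'.chainFine hδ
  rw [← D.chainSum_ofFn_eq h0, ← D'.chainSum_ofFn_eq h0]
  generalize List.ofFn D.t = l at c
  generalize List.ofFn D'.t = l' at c'
  have hperm := List.perm_insertionSort (· ≤ ·) (l ++ l')
  have hs := List.pairwise_insertionSort (· ≤ ·) (l ++ l')
  generalize List.insertionSort (· ≤ ·) (l ++ l') = m at hperm hs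
  have hmem : ∀ z ∈ m, z ∈ Icc a b := by
    intro z hz
    rcases List.mem_append.1 (hperm.mem_iff.1 hz) with h | h
    · exact c.pairwise.2.2 z h
    · exact c'.pairwise.2.2 z h
  have h1 := norm_chainSum_sub_chainSum_le hθ hε hv hΞ le_rfl le_rfl c
    (List.sublist_of_subperm_of_pairwise
      ((List.sublist_append_left l l').subperm.trans hperm.symm.subperm) c.pairwise.2.1 hs) hs hmem
  have h2 := norm_chainSum_sub_chainSum_le hθ hε hv hΞ le_rfl le_rfl c'
    (List.sublist_of_subperm_of_pairwise
      ((List.sublist_append_right l l').subperm.trans hperm.symm.subperm) c'.pairwise.2.1 hs)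
    hs hmem
  calc _ = ‖(chainSum Ξ a m b - chainSum Ξ a l' b) - (chainSum Ξ a m b - chainSum Ξ a l b)‖ := by
        congr 1; abel
    _ ≤ _ := norm_sub_le _ _
    _ ≤ _ := by linarith

end YoungPartition

section Sewing

variable {F : Type*} [NormedAddCommGroup F] {Ξ : ℝ → ℝ → F} {v : ℝ → ℝ} {θ T : ℝ}

/-- On small subintervals of `[0,T]`, the defect of additivity of `Ξ` is small compared with the
power `θ` of the increment of `v`. -/
def AlmostAdditive (Ξ : ℝ → ℝ → F) (v : ℝ → ℝ) (θ T : ℝ) : Prop :=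
  ∀ ε > 0, ∃ δ > 0, ∀ x y, 0 ≤ x → x ≤ y → y ≤ T → y - x ≤ δ → DefectLE Ξ v θ ε x y

/-- The sewing lemma: sums of an almost additive function converge as the mesh tends to `0`. -/
theorem AlmostAdditive.exists_tendsto [CompleteSpace F] (hΞ : AlmostAdditive Ξ v θ T)
    (hθ : 1 < θ) (hv : MonotoneOn v (Icc 0 T)) (h0 : ∀ s, Ξ s s = 0) {t : ℝ}
    (ht : t ∈ Icc 0 T) :
    ∃ I, Tendsto (fun D : YoungPartition 0 t => D.sum Ξ)
      (comap YoungPartition.mesh (𝓝 0)) (𝓝 I) := by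
  have := YoungPartition.neBot ht.1
  rw [← cauchy_map_iff_exists_tendsto, Metric.cauchy_iff]
  refine ⟨inferInstance, fun η hη => ?_⟩
  set B := 2 * (sewingConst θ * (v t - v 0) ^ θ)
  have hB : 0 ≤ B := by
    have := sewingConst_pos hθ
    have := sub_nonneg.2 (hv ⟨le_rfl, ht.1.trans ht.2⟩ ht ht.1)
    positivity
  obtain ⟨δ, hδ, hd⟩ := hΞ (η / (B + 1)) (by positivity)
  refine ⟨_, image_mem_map (YoungPartition.eventually_fine hδ), ?_⟩
  rintro _ ⟨D, hD, rfl⟩ _ ⟨D', hD', rfl⟩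
  rw [dist_eq_norm]
  have h := YoungPartition.norm_sum_sub_sum_le hθ (by positivity) hδ.le
    (hv.mono (Icc_subset_Icc_right ht.2)) h0
    (fun x y hx hxy hy => hd x y hx hxy (hy.trans ht.2)) hD hD'
  calc _ ≤ _ := h
    _ = η * (B / (B + 1)) := by simp only [B]; ring
    _ < η * 1 := by gcongr; rw [div_lt_one (by positivity)]; linarith
    _ = η := mul_one η

/-- The local estimate for the limits provided by the sewing lemma. -/
theorem AlmostAdditive.norm_sub_sub_le (hΞ : AlmostAdditive Ξ v θ T) (hθ : 1 < θ)
    (hv : MonotoneOn v (Icc 0 T)) {ε : ℝ} (hε : 0 < ε) :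
    ∃ δ > 0, ∀ s t I J, 0 ≤ s → s ≤ t → t ≤ T → t - s ≤ δ →
      Tendsto (fun D : YoungPartition 0 s => D.sum Ξ) (comap YoungPartition.mesh (𝓝 0)) (𝓝 I) →
      Tendsto (fun D : YoungPartition 0 t => D.sum Ξ) (comap YoungPartition.mesh (𝓝 0)) (𝓝 J) →
      ‖J - I - Ξ s t‖ ≤ ε * sewingConst θ * (v t - v s) ^ θ := by
  obtain ⟨δ, hδ, hd⟩ := hΞ ε hε
  refine ⟨δ, hδ, fun s t I J hs hst ht hts hI hJ => le_of_forall_pos_le_add fun η hη => ?_⟩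
  have key : ∀ {r : ℝ} {L : F}, Tendsto (fun D : YoungPartition 0 r => D.sum Ξ)
      (comap YoungPartition.mesh (𝓝 0)) (𝓝 L) →
      ∃ ρ > 0, ∀ D : YoungPartition 0 r, D.Fine ρ → ‖D.sum Ξ - L‖ ≤ η / 2 := by
    intro r L hL
    have := hL.eventually (Metric.closedBall_mem_nhds L (half_pos hη))
    obtain ⟨S, hS, hS'⟩ := this
    obtain ⟨ρ, hρ, hS⟩ := Metric.mem_nhds_iff.1 hS
    refine ⟨ρ / 2, half_pos hρ, fun D hD => ?_⟩
    have : D ∈ YoungPartition.mesh ⁻¹' S := hS (by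
      rw [mem_ball_zero_iff, Real.norm_of_nonneg D.mesh_nonneg]
      exact ((D.mesh_le_iff (half_pos hρ).le).2 hD).trans_lt (half_lt_self hρ))
    simpa [dist_eq_norm] using hS' this
  obtain ⟨ρ, hρ, h1⟩ := key hI
  obtain ⟨ρ', hρ', h2⟩ := key hJ
  have hm : 0 < min ρ ρ' := lt_min hρ hρ'
  obtain ⟨D, hD⟩ := YoungPartition.exists_fine hm hs
  obtain ⟨l, hl⟩ := exists_chainFine hm hst
  obtain ⟨D', hD', hsum⟩ := D.exists_append Ξ hD hl
  have h3 := norm_chainSum_sub_le hθ hε.le (hv.mono (Icc_subset_Icc hs ht))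
    (hd s t hs hst ht hts) le_rfl hst le_rfl hl.pairwise.2.1 hl.pairwise.2.2
  have h4 := h1 D fun i => (hD i).trans (min_le_left _ _)
  have h5 := h2 D' fun i => (hD' i).trans (min_le_right _ _)
  calc _ = ‖(chainSum Ξ s l t - Ξ s t) + ((D.sum Ξ - I) - (D'.sum Ξ - J))‖ := by
        rw [hsum]; congr 1; abel
    _ ≤ _ := (norm_add_le _ _).trans (add_le_add_right (norm_sub_le _ _) _)
    _ ≤ _ := by linarith

end Sewing

section Control

variable {E : Type*} [NormedAddCommGroup E] {p T : ℝ} {X : ℝ → E} {v : ℝ → ℝ}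

namespace YoungPartition

variable {a b : ℝ}

theorem sum_sub_eq {F : Type*} [NormedAddCommGroup F] (g : ℝ → F) (D : YoungPartition a b) :
    D.sum (fun s t => g t - g s) = g b - g a := by
  have : ∀ (k : ℕ) (t : Fin (k + 1) → ℝ),
      ∑ i : Fin k, (g (t i.succ) - g (t i.castSucc)) = g (t (Fin.last k)) - g (t 0) := by
    intro k t
    induction k with
    | zero => simp
    | succ k ih =>
      rw [Fin.sum_univ_castSucc]
      have := ih fun i => t i.castSucc
      simp only [← Fin.succ_castSucc, Fin.castSucc_zero] at this
      rw [this, Fin.succ_last]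
      abel
  rw [sum, this, D.first, D.last]

end YoungPartition

theorem ofReal_sum_rpow_eq (hp : 0 ≤ p) {k : ℕ} (t : Fin (k + 1) → ℝ) :
    ENNReal.ofReal (∑ i : Fin k, ‖X (t i.succ) - X (t i.castSucc)‖ ^ p) =
      ∑ i : Fin k, (‖X (t i.succ) - X (t i.castSucc)‖₊ : ENNReal) ^ p := by
  rw [ENNReal.ofReal_sum_of_nonneg fun i _ => by positivity]
  refine Finset.sum_congr rfl fun i _ => ?_
  rw [← ENNReal.ofReal_rpow_of_nonneg (norm_nonneg _) hp, ofReal_norm]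
  rfl

/-- A monotone function `v` whose increments dominate the `p`-th powers of those of `X`. -/
structure IsControl (p T : ℝ) (X : ℝ → E) (v : ℝ → ℝ) : Prop where
  mono : MonotoneOn v (Icc 0 T)
  rpow_le : ∀ s t, 0 ≤ s → s ≤ t → t ≤ T → ‖X t - X s‖ ^ p ≤ v t - v s

theorem IsControl.norm_le (h : IsControl p T X v) (hp : 0 < p) {s t : ℝ} (hs : 0 ≤ s)
    (hst : s ≤ t) (ht : t ≤ T) : ‖X t - X s‖ ≤ (v t - v s) ^ (1 / p) := by
  have := Real.rpow_le_rpow (by positivity) (h.rpow_le s t hs hst ht) (one_div_pos.2 hp).le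
  rwa [← Real.rpow_mul (norm_nonneg _), mul_one_div_cancel hp.ne', Real.rpow_one] at this

theorem IsControl.pVar_lt_top (h : IsControl p T X v) (hp : 0 < p) : pVar p X 0 T < ⊤ := by
  refine lt_of_le_of_lt (b := ENNReal.ofReal (v T - v 0) ^ (1 / p)) ?_
    (ENNReal.rpow_lt_top_of_nonneg (by positivity) ENNReal.ofReal_ne_top)
  refine iSup_le fun k => iSup_le fun t => iSup_le fun ht => ?_
  refine ENNReal.rpow_le_rpow ?_ (by positivity)
  rw [← ofReal_sum_rpow_eq hp.le]
  refine ENNReal.ofReal_le_ofReal ?_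
  set D : YoungPartition 0 T := ⟨k, t, ht.1, ht.2.1, ht.2.2⟩
  rw [← D.sum_sub_eq v]
  exact Finset.sum_le_sum fun i _ => h.rpow_le _ _ (D.mem_Icc _).1 (D.step_le i) (D.mem_Icc _).2

theorem MemVp.exists_isControl (h : MemVp p X 0 T) (hp : 0 < p) :
    ∃ v, IsControl p T X v := by
  set Ξ : ℝ → ℝ → ℝ := fun s t => ‖X t - X s‖ ^ p
  have hΞ : ∀ s t, 0 ≤ Ξ s t := fun s t => by positivity
  have hbdd : ∀ D : YoungPartition 0 T, D.sum Ξ ≤ (pVar p X 0 T ^ p).toReal := by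
    intro D
    rw [← ENNReal.ofReal_le_iff_le_toReal (ENNReal.rpow_ne_top_of_nonneg hp.le h.2.ne)]
    refine (ofReal_sum_rpow_eq hp.le D.t).trans_le ?_
    rw [← ENNReal.rpow_inv_le_iff hp, ← one_div]
    exact le_iSup_of_le D.k (le_iSup_of_le D.t (le_iSup_of_le ⟨D.mono, D.first, D.last⟩ le_rfl))
  have hbdd' : ∀ t ≤ T, BddAbove (range fun D : YoungPartition 0 t => D.sum Ξ) := by
    rintro t ht
    refine ⟨(pVar p X 0 T ^ p).toReal, ?_⟩
    rintro _ ⟨D, rfl⟩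
    refine le_trans ?_ (hbdd (D.snoc ht))
    rw [YoungPartition.sum_snoc]
    linarith [hΞ t T]
  have key : ∀ s t, 0 ≤ s → s ≤ t → t ≤ T → Ξ s t ≤
      (⨆ D : YoungPartition 0 t, D.sum Ξ) - ⨆ D : YoungPartition 0 s, D.sum Ξ := by
    intro s t hs hst ht
    have : Nonempty (YoungPartition 0 s) := ⟨(YoungPartition.single 0).snoc hs⟩
    suffices (⨆ D : YoungPartition 0 s, D.sum Ξ) ≤ (⨆ D : YoungPartition 0 t, D.sum Ξ) - Ξ s t by
      linarith
    refine ciSup_le fun D => ?_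
    have := le_ciSup (hbdd' t ht) (D.snoc hst)
    rw [YoungPartition.sum_snoc] at this
    linarith
  exact ⟨fun t => ⨆ D : YoungPartition 0 t, D.sum Ξ,
    fun s hs t ht hst => sub_nonneg.1 ((hΞ s t).trans (key s t hs.1 hst ht.2)), key⟩

theorem IsControl.add {E' : Type*} [NormedAddCommGroup E'] {Y : ℝ → E'} {w : ℝ → ℝ}
    (hX : IsControl p T X v) (hY : IsControl p T Y w) :
    IsControl p T X (fun t => v t + w t) ∧ IsControl p T Y (fun t => v t + w t) := by
  have hm : MonotoneOn (fun t => v t + w t) (Icc 0 T) := hX.mono.add hY.mono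
  refine ⟨⟨hm, fun s t hs hst ht => ?_⟩, ⟨hm, fun s t hs hst ht => ?_⟩⟩
  · have := hX.rpow_le s t hs hst ht
    have := hY.mono ⟨hs, hst.trans ht⟩ ⟨hs.trans hst, ht⟩ hst
    linarith
  · have := hY.rpow_le s t hs hst ht
    have := hX.mono ⟨hs, hst.trans ht⟩ ⟨hs.trans hst, ht⟩ hst
    linarith

theorem exists_norm_sub_le_of_continuousOn (hX : ContinuousOn X (Icc 0 T)) {η : ℝ} (hη : 0 < η) :
    ∃ δ > 0, ∀ s t, 0 ≤ s → s ≤ t → t ≤ T → t - s ≤ δ → ‖X t - X s‖ ≤ η := by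
  obtain ⟨δ, hδ, h⟩ := Metric.uniformContinuousOn_iff_le.1
    (isCompact_Icc.uniformContinuousOn_of_continuous hX) η hη
  refine ⟨δ, hδ, fun s t hs hst ht hts => ?_⟩
  rw [← dist_eq_norm]
  refine h t ⟨hs.trans hst, ht⟩ s ⟨hs, hst.trans ht⟩ ?_
  rwa [Real.dist_eq, abs_of_nonneg (sub_nonneg.2 hst)]

end Control

section Young

variable {E F : Type*} [NormedAddCommGroup E] [NormedSpace ℝ E] [NormedAddCommGroup F]
  [NormedSpace ℝ F] {p γ C T : ℝ} {X : ℝ → E} {v : ℝ → ℝ} {Z : ℝ → E →L[ℝ] F}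

theorem almostAdditive_young (hp : 1 ≤ p) (hγ1 : γ ≤ 1) (hγp : p < 1 + γ)
    (hC : 0 ≤ C) (hX : ContinuousOn X (Icc 0 T)) (hv : IsControl p T X v)
    (hZ : ∀ s t, 0 ≤ s → s ≤ t → t ≤ T → ‖Z t - Z s‖ ≤ C * (v t - v s) ^ (γ / p)) :
    AlmostAdditive (fun s t => Z s (X t - X s)) v ((1 + γ + p) / (2 * p)) T := by
  intro ε hε
  have hp0 : 0 < p := by linarith
  have hγ0 : 0 < γ := by linarith
  set κ := (1 + γ - p) / 2 with hκ
  have hκ0 : 0 < κ := by rw [hκ]; linarith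
  have hκ1 : 0 ≤ 1 - κ := by rw [hκ]; linarith
  obtain ⟨δ, hδ, hXδ⟩ := exists_norm_sub_le_of_continuousOn hX
    (η := (ε / (C + 1)) ^ (1 / κ)) (by positivity)
  refine ⟨δ, hδ, fun x y hx hxy hy hyx s u t hs hsu hut ht => ?_⟩
  have hs0 := hx.trans hs
  have hu0 := hs0.trans hsu
  have htT := ht.trans hy
  have hvu := hv.mono ⟨hs0, hsu.trans (hut.trans htT)⟩ ⟨hu0, hut.trans htT⟩ hsu
  have hvt := hv.mono ⟨hu0, hut.trans htT⟩ ⟨hu0.trans hut, htT⟩ hut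
  set w := v t - v s with hw
  have hw0 : 0 ≤ w := by linarith
  have h1 : ‖X t - X u‖ ^ κ ≤ ε / (C + 1) := by
    have := Real.rpow_le_rpow (norm_nonneg _) (hXδ u t hu0 hut htT (by linarith)) hκ0.le
    rwa [← Real.rpow_mul (by positivity), one_div_mul_cancel hκ0.ne', Real.rpow_one] at this
  have h2 : ‖X t - X u‖ ^ (1 - κ) ≤ w ^ ((1 - κ) / p) := by
    have := (hv.norm_le hp0 hu0 hut htT).trans
      (Real.rpow_le_rpow (by linarith) (show v t - v u ≤ w by linarith) (by positivity))
    have := Real.rpow_le_rpow (norm_nonneg _) this hκ1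
    rwa [← Real.rpow_mul hw0, one_div_mul_eq_div] at this
  have h3 : ‖Z u - Z s‖ ≤ C * w ^ (γ / p) := by
    refine (hZ s u hs0 hsu (hut.trans htT)).trans ?_
    gcongr
    linarith
  have h4 : ‖X t - X u‖ = ‖X t - X u‖ ^ κ * ‖X t - X u‖ ^ (1 - κ) := by
    rw [← Real.rpow_add_of_nonneg (norm_nonneg _) hκ0.le hκ1]
    simp
  have h5 : w ^ ((1 + γ + p) / (2 * p)) = w ^ (γ / p) * w ^ ((1 - κ) / p) := by
    rw [← Real.rpow_add_of_nonneg hw0 (by positivity) (by positivity)]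
    congr 1
    rw [hκ]
    field_simp
    ring
  calc _ = ‖(Z u - Z s) (X t - X u)‖ := by
        rw [← norm_neg]
        congr 1
        simp only [sub_apply, map_sub]
        abel
    _ ≤ ‖Z u - Z s‖ * ‖X t - X u‖ := ContinuousLinearMap.le_opNorm _ _
    _ ≤ (C * w ^ (γ / p)) * (ε / (C + 1) * w ^ ((1 - κ) / p)) := by
        rw [h4]
        gcongr
    _ = ε * (C / (C + 1)) * w ^ ((1 + γ + p) / (2 * p)) := by rw [h5]; ring
    _ ≤ ε * 1 * w ^ ((1 + γ + p) / (2 * p)) := by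
        gcongr
        rw [div_le_one (by positivity)]
        linarith
    _ = _ := by rw [mul_one]

theorem one_lt_young_exponent (hp : 0 < p) (hγp : p < 1 + γ) : 1 < (1 + γ + p) / (2 * p) := by
  rw [one_lt_div (by positivity)]
  linarith

/-- Existence of the Young integral. -/
theorem exists_isYoungIntegral [CompleteSpace F] (hp : 1 ≤ p) (hγ1 : γ ≤ 1)
    (hγp : p < 1 + γ) (hC : 0 ≤ C) (hX : ContinuousOn X (Icc 0 T)) (hv : IsControl p T X v)
    (hZ : ∀ s t, 0 ≤ s → s ≤ t → t ≤ T → ‖Z t - Z s‖ ≤ C * (v t - v s) ^ (γ / p))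
    {t : ℝ} (ht : t ∈ Icc 0 T) : ∃ I, IsYoungIntegral Z X 0 t I :=
  (almostAdditive_young hp hγ1 hγp hC hX hv hZ).exists_tendsto
    (one_lt_young_exponent (by linarith) hγp) hv.mono (by simp) ht

/-- The Young integral is approximated by its germ up to a small multiple of the control. -/
theorem exists_norm_young_sub_le (hp : 1 ≤ p) (hγ1 : γ ≤ 1)
    (hγp : p < 1 + γ) (hC : 0 ≤ C) (hX : ContinuousOn X (Icc 0 T)) (hv : IsControl p T X v)
    (hZ : ∀ s t, 0 ≤ s → s ≤ t → t ≤ T → ‖Z t - Z s‖ ≤ C * (v t - v s) ^ (γ / p))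
    {J : ℝ → F} (hJ : ∀ t ∈ Icc 0 T, IsYoungIntegral Z X 0 t (J t)) {ε : ℝ} (hε : 0 < ε) :
    ∃ δ > 0, ∀ s t, 0 ≤ s → s ≤ t → t ≤ T → t - s ≤ δ →
      ‖J t - J s - Z s (X t - X s)‖ ≤ ε * (v t - v s) := by
  have hθ := one_lt_young_exponent (by linarith) hγp
  have hA := almostAdditive_young hp hγ1 hγp hC hX hv hZ
  generalize (1 + γ + p) / (2 * p) = θ at hθ hA
  have hK := sewingConst_pos hθ
  set V := |v T - v 0| ^ (θ - 1)
  have hV : 0 ≤ V := by positivity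
  obtain ⟨δ, hδ, h⟩ := hA.norm_sub_sub_le hθ hv.mono (ε := ε / (sewingConst θ * (V + 1)))
    (by positivity)
  refine ⟨δ, hδ, fun s t hs hst ht hts => ?_⟩
  have h1 := h s t (J s) (J t) hs hst ht hts (hJ s ⟨hs, hst.trans ht⟩) (hJ t ⟨hs.trans hst, ht⟩)
  have hT : 0 ≤ T := hs.trans (hst.trans ht)
  have m1 := hv.mono ⟨le_rfl, hT⟩ ⟨hs, hst.trans ht⟩ hs
  have m2 := hv.mono ⟨hs, hst.trans ht⟩ ⟨hs.trans hst, ht⟩ hst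
  have m3 := hv.mono ⟨hs.trans hst, ht⟩ ⟨hT, le_rfl⟩ ht
  have hw0 : 0 ≤ v t - v s := sub_nonneg.2 m2
  have hw : (v t - v s) ^ θ ≤ V * (v t - v s) := by
    calc (v t - v s) ^ θ = (v t - v s) ^ (θ - 1 + 1) := by ring_nf
      _ = (v t - v s) ^ (θ - 1) * (v t - v s) := by
        rw [Real.rpow_add_of_nonneg (by linarith) (by linarith) zero_le_one, Real.rpow_one]
      _ ≤ _ := by
        gcongr
        simp only [V]
        apply Real.rpow_le_rpow hw0 _ (by linarith)
        exact le_trans (by linarith) (le_abs_self _)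
  calc _ ≤ _ := h1
    _ ≤ ε / (sewingConst θ * (V + 1)) * sewingConst θ * (V * (v t - v s)) := by gcongr
    _ = ε * (V / (V + 1)) * (v t - v s) := by field_simp
    _ ≤ ε * 1 * (v t - v s) := by
      gcongr
      rw [div_le_one (by positivity)]
      linarith
    _ = _ := by rw [mul_one]

/-- A path whose increments are approximated by the germ `Z s (X t - X s)` is the Young
integral of `Z` against `X`. -/
theorem isYoungIntegral_of_norm_sub_le (hv : MonotoneOn v (Icc 0 T)) {J : ℝ → F}
    (h : ∀ ε > 0, ∃ δ > 0, ∀ s t, 0 ≤ s → s ≤ t → t ≤ T → t - s ≤ δ →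
      ‖J t - J s - Z s (X t - X s)‖ ≤ ε * (v t - v s)) {t : ℝ} (ht : t ∈ Icc 0 T) :
    IsYoungIntegral Z X 0 t (J t - J 0) := by
  rw [IsYoungIntegral, Metric.tendsto_nhds]
  intro η hη
  have hvt := hv ⟨le_rfl, ht.1.trans ht.2⟩ ht ht.1
  set V := v t - v 0 with hV
  have hV0 : 0 ≤ V := by linarith
  obtain ⟨δ, hδ, hd⟩ := h (η / (V + 1)) (by positivity)
  filter_upwards [YoungPartition.eventually_fine hδ] with D hD
  rw [dist_comm, dist_eq_norm, ← D.sum_sub_eq J, YoungPartition.sum, riemannSum,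
    ← Finset.sum_sub_distrib]
  calc _ ≤ ∑ i : Fin D.k, η / (V + 1) * (v (D.t i.succ) - v (D.t i.castSucc)) :=
        norm_sum_le_of_le _ fun i _ => hd _ _ (D.mem_Icc _).1 (D.step_le i)
          ((D.mem_Icc _).2.trans ht.2) (hD i)
    _ = η / (V + 1) * V := by
        rw [← Finset.mul_sum, hV, ← D.sum_sub_eq v, YoungPartition.sum]
    _ = η * (V / (V + 1)) := by ring
    _ < η * 1 := by gcongr; rw [div_lt_one (by positivity)]; linarith
    _ = η := mul_one η

end Young

section Taylor

variable {E F : Type*} [NormedAddCommGroup E] [NormedSpace ℝ E] [NormedAddCommGroup F]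
  [NormedSpace ℝ F]

/-- A second order Taylor estimate, uniform near a compact set. -/
theorem ContDiff.exists_norm_sub_sub_fderiv_le {Φ : E → F} (hΦ : ContDiff ℝ 2 Φ) {K : Set E}
    (hK : IsCompact K) :
    ∃ C ≥ 0, ∃ δ > 0, ∀ x ∈ K, ∀ y, ‖y - x‖ ≤ δ →
      ‖Φ y - Φ x - fderiv ℝ Φ x (y - x)‖ ≤ C * ‖y - x‖ ^ 2 := by
  refine hK.induction_on (p := fun S => ∃ C ≥ (0 : ℝ), ∃ δ > 0, ∀ x ∈ S, ∀ y, ‖y - x‖ ≤ δ →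
      ‖Φ y - Φ x - fderiv ℝ Φ x (y - x)‖ ≤ C * ‖y - x‖ ^ 2) ⟨0, le_rfl, 1, one_pos, by simp⟩
    ?_ ?_ ?_
  · rintro s t hst ⟨C, hC, δ, hδ, h⟩
    exact ⟨C, hC, δ, hδ, fun x hx => h x (hst hx)⟩
  · rintro s t ⟨C, hC, δ, hδ, h⟩ ⟨C', -, δ', hδ', h'⟩
    refine ⟨max C C', hC.trans (le_max_left _ _), min δ δ', lt_min hδ hδ', ?_⟩
    rintro x (hx | hx) y hy
    · exact (h x hx y (hy.trans (min_le_left _ _))).trans (by gcongr; exact le_max_left _ _)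
    · exact (h' x hx y (hy.trans (min_le_right _ _))).trans (by gcongr; exact le_max_right _ _)
  · intro x₀ _
    have hd : ContDiff ℝ 1 (fderiv ℝ Φ) := hΦ.fderiv_right (by norm_num)
    obtain ⟨L, t, ht, hL⟩ := hd.locallyLipschitz x₀
    obtain ⟨r, hr, hrt⟩ := Metric.mem_nhds_iff.1 ht
    refine ⟨Metric.ball x₀ (r / 2), mem_nhdsWithin_of_mem_nhds (Metric.ball_mem_nhds _
      (half_pos hr)), L, L.2, r / 4, by positivity, fun x hx y hy => ?_⟩
    have hsub : Metric.closedBall x ‖y - x‖ ⊆ t := by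
      intro z hz
      apply hrt
      rw [Metric.mem_ball, Metric.mem_closedBall] at *
      linarith [dist_triangle z x x₀]
    have := (convex_closedBall x ‖y - x‖).norm_image_sub_le_of_norm_fderiv_le'
      (f := Φ) (φ := fderiv ℝ Φ x) (C := L * ‖y - x‖) (x := x) (y := y)
      (fun z _ => (hΦ.differentiable (by norm_num)).differentiableAt)
      (fun z hz => by
        have h := hL.dist_le_mul z (hsub hz) x (hsub (by simp))
        rw [dist_eq_norm] at h
        exact h.trans (by gcongr; exact hz))
      (by simp) (by simp [dist_eq_norm])
    calc _ ≤ _ := this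
      _ = _ := by ring

end Taylor

section Coordinates

variable {n : ℕ} {F : Type*} [NormedAddCommGroup F] [NormedSpace ℝ F]

theorem sum_smul_apply_single (A : (Fin n → ℝ) →L[ℝ] F) (h : Fin n → ℝ) :
    A h = ∑ i, h i • A (Pi.single i 1) := by
  conv_lhs => rw [pi_eq_sum_univ' h, map_sum]
  simp only [map_smul]

theorem sum_riemannSum_coord (Z : ℝ → (Fin n → ℝ) →L[ℝ] F) (X : ℝ → Fin n → ℝ) {a b : ℝ}
    (D : YoungPartition a b) :
    ∑ i, riemannSum (fun s => toCLM (Z s (Pi.single i 1))) (fun s => X s i) D =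
      riemannSum Z X D := by
  simp only [riemannSum]
  rw [Finset.sum_comm]
  refine Finset.sum_congr rfl fun j _ => ?_
  rw [sum_smul_apply_single]
  simp [toCLM]

theorem isYoungIntegral_sum_coord {Z : ℝ → (Fin n → ℝ) →L[ℝ] F} {X : ℝ → Fin n → ℝ} {a b : ℝ}
    {I : Fin n → F} (hI : ∀ i, IsYoungIntegral (fun s => toCLM (Z s (Pi.single i 1)))
      (fun s => X s i) a b (I i)) : IsYoungIntegral Z X a b (∑ i, I i) := by
  have := tendsto_finsetSum Finset.univ fun i _ => hI i
  simp only [sum_riemannSum_coord] at this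
  exact this

end Coordinates

theorem norm_toCLM {E : Type*} [NormedAddCommGroup E] [NormedSpace ℝ E] (x : E) :
    ‖toCLM x‖ = ‖x‖ := by
  simp [toCLM]

/-- If `Φ_* f_i = f_i`, i.e. `DΦ(y)(f_i(y)) = f_i(Φ(y))` for all `y` and `i`, then `Φ` is a
symmetry of `dY = Σ_i f_i(Y)dX^i`: for every solution `Y` starting at `y₀`, `Φ ∘ Y` is a
solution starting at `Φ(y₀)`. -/
theorem symmetry_young_coordinates
    {n : ℕ} {E₁ : Type*} [NormedAddCommGroup E₁] [NormedSpace ℝ E₁] [CompleteSpace E₁]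
    (p γ T : ℝ) (hp1 : 1 ≤ p) (hp2 : p < 2) (hγ0 : 0 < γ) (hγ1 : γ ≤ 1)
    (hγp : 1 + γ > p) (hT : 0 ≤ T)
    (X : ℝ → Fin n → ℝ) (hX : MemVp p X 0 T)
    (f : E₁ → (Fin n → ℝ) →L[ℝ] E₁)
    (hf : ∃ C : ℝ, ∀ x y : E₁, ‖f x - f y‖ ≤ C * ‖x - y‖ ^ γ)
    (Φ : E₁ → E₁) (hΦ : ContDiff ℝ 2 Φ)
    (hsym : ∀ (y : E₁) (i : Fin n),
      fderiv ℝ Φ y (f y (Pi.single i 1)) = f (Φ y) (Pi.single i 1))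
    (y₀ : E₁) (Y : ℝ → E₁) (hY : IsYoungSolution p T X f y₀ Y) :
    IsYoungSolution p T X f (Φ y₀) (fun t => Φ (Y t)) := by
  have hp0 : 0 < p := by linarith
  obtain ⟨hY0, hYV, hYI⟩ := hY
  obtain ⟨C, hC⟩ := hf
  obtain ⟨vX, hvX⟩ := hX.exists_isControl hp0
  obtain ⟨vY, hvY⟩ := hYV.exists_isControl hp0
  obtain ⟨hvX, hvY⟩ := hvX.add hvY
  generalize (fun t => vX t + vY t) = v at hvX hvY
  have hK : IsCompact (Y '' Icc 0 T) := isCompact_Icc.image_of_continuousOn hYV.1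
  obtain ⟨L, hL⟩ := LocallyLipschitzOn.exists_lipschitzOnWith_of_compact hK
    ((hΦ.of_le (by norm_num)).locallyLipschitz.locallyLipschitzOn (s := Y '' Icc 0 T))
  have hΦY : ∀ s t, 0 ≤ s → s ≤ t → t ≤ T → ‖Φ (Y t) - Φ (Y s)‖ ≤ L * ‖Y t - Y s‖ := by
    intro s t hs hst ht
    rw [← dist_eq_norm, ← dist_eq_norm]
    exact hL.dist_le_mul _ ⟨t, ⟨hs.trans hst, ht⟩, rfl⟩ _ ⟨s, ⟨hs, hst.trans ht⟩, rfl⟩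
  have holder : ∀ (W : ℝ → E₁) (M : ℝ), 0 ≤ M →
      (∀ s t, 0 ≤ s → s ≤ t → t ≤ T → ‖W t - W s‖ ≤ M * ‖Y t - Y s‖) →
      ∀ s t, 0 ≤ s → s ≤ t → t ≤ T →
        ‖f (W t) - f (W s)‖ ≤ |C| * M ^ γ * (v t - v s) ^ (γ / p) := by
    intro W M hM hW s t hs hst ht
    have hw := sub_nonneg.2 (hvY.mono ⟨hs, hst.trans ht⟩ ⟨hs.trans hst, ht⟩ hst)
    calc _ ≤ C * ‖W t - W s‖ ^ γ := hC _ _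
      _ ≤ |C| * (M * (v t - v s) ^ (1 / p)) ^ γ := by
        gcongr
        · exact le_abs_self C
        · exact (hW s t hs hst ht).trans (by gcongr; exact hvY.norm_le hp0 hs hst ht)
      _ = _ := by
        rw [Real.mul_rpow hM (by positivity), ← Real.rpow_mul hw, one_div_mul_eq_div, mul_assoc]
  have hfY := holder Y 1 zero_le_one fun s t _ _ _ => (one_mul _).ge
  have hfΦ := holder (fun t => Φ (Y t)) L L.2 hΦY
  have hYint : ∀ t ∈ Icc 0 T, IsYoungIntegral (fun s => f (Y s)) X 0 t (Y t - y₀) := by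
    intro t ht
    obtain ⟨I, hI, hIt⟩ := hYI t ht
    rw [hIt, add_sub_cancel_left]
    exact isYoungIntegral_sum_coord hI
  have hsym' : ∀ y h, fderiv ℝ Φ y (f y h) = f (Φ y) h := by
    intro y h
    rw [sum_smul_apply_single (f y), sum_smul_apply_single (f (Φ y)), map_sum]
    simp only [map_smul, hsym]
  have hΦint : ∀ t ∈ Icc 0 T,
      IsYoungIntegral (fun s => f (Φ (Y s))) X 0 t (Φ (Y t) - Φ (Y 0)) := by
    intro t ht
    refine isYoungIntegral_of_norm_sub_le (J := fun t => Φ (Y t)) hvY.mono (fun ε hε => ?_) ht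
    obtain ⟨A, hA, δ₀, hδ₀, hTaylor⟩ := hΦ.exists_norm_sub_sub_fderiv_le hK
    obtain ⟨B, hB⟩ := hK.exists_bound_of_continuousOn
      (hΦ.continuous_fderiv (by norm_num)).continuousOn
    have hB0 : 0 ≤ B := (norm_nonneg _).trans (hB (Y t) ⟨t, ht, rfl⟩)
    have hp2' : 0 < 2 - p := by linarith
    obtain ⟨δ₁, hδ₁, h₁⟩ := exists_norm_young_sub_le hp1 hγ1 hγp (by positivity) hX.1 hvX hfY
      hYint (ε := ε / (2 * (B + 1))) (by positivity)
    obtain ⟨δ₂, hδ₂, h₂⟩ := exists_norm_sub_le_of_continuousOn hYV.1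
      (η := min δ₀ ((ε / (2 * (A + 1))) ^ (1 / (2 - p)))) (by positivity)
    refine ⟨min δ₁ δ₂, lt_min hδ₁ hδ₂, fun s u hs hsu hu hus => ?_⟩
    have e₁ := h₁ s u hs hsu hu (hus.trans (min_le_left _ _))
    have e₂ := h₂ s u hs hsu hu (hus.trans (min_le_right _ _))
    have hYs : Y s ∈ Y '' Icc 0 T := ⟨s, ⟨hs, hsu.trans hu⟩, rfl⟩
    have e₃ := hTaylor (Y s) hYs (Y u) (e₂.trans (min_le_left _ _))
    have e₄ : ‖Y u - Y s‖ ^ (2 - p) ≤ ε / (2 * (A + 1)) := by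
      have := Real.rpow_le_rpow (norm_nonneg _) (e₂.trans (min_le_right _ _)) hp2'.le
      rwa [← Real.rpow_mul (by positivity), one_div_mul_cancel hp2'.ne', Real.rpow_one] at this
    have e₅ : ‖Y u - Y s‖ ^ 2 ≤ ε / (2 * (A + 1)) * (v u - v s) := by
      calc ‖Y u - Y s‖ ^ 2 = ‖Y u - Y s‖ ^ (2 - p) * ‖Y u - Y s‖ ^ p := by
            rw [← Real.rpow_add_of_nonneg (norm_nonneg _) hp2'.le hp0.le, ← Real.rpow_natCast]
            norm_num
        _ ≤ _ := by
            gcongr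
            exact hvY.rpow_le s u hs hsu hu
    have hw := sub_nonneg.2 (hvY.mono ⟨hs, hsu.trans hu⟩ ⟨hs.trans hsu, hu⟩ hsu)
    have hA1 : A / (A + 1) ≤ 1 := by rw [div_le_one (by positivity)]; linarith
    have hB1 : B / (B + 1) ≤ 1 := by rw [div_le_one (by positivity)]; linarith
    rw [sub_sub_sub_cancel_right] at e₁
    calc _ = ‖(Φ (Y u) - Φ (Y s) - fderiv ℝ Φ (Y s) (Y u - Y s)) +
            fderiv ℝ Φ (Y s) (Y u - Y s - f (Y s) (X u - X s))‖ := by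
          rw [map_sub (fderiv ℝ Φ (Y s)) (Y u - Y s), hsym']
          congr 1
          abel
      _ ≤ A * ‖Y u - Y s‖ ^ 2 + B * ‖Y u - Y s - f (Y s) (X u - X s)‖ :=
          (norm_add_le _ _).trans (add_le_add e₃
            ((ContinuousLinearMap.le_opNorm _ _).trans (by gcongr; exact hB _ hYs)))
      _ ≤ A * (ε / (2 * (A + 1)) * (v u - v s)) + B * (ε / (2 * (B + 1)) * (v u - v s)) := by
          gcongr
      _ = (A / (A + 1) + B / (B + 1)) * (ε / 2 * (v u - v s)) := by field_simp
      _ ≤ (1 + 1) * (ε / 2 * (v u - v s)) := by gcongr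
      _ = ε * (v u - v s) := by ring
  refine ⟨congrArg Φ hY0, ⟨hΦ.continuous.comp_continuousOn hYV.1, ?_⟩, fun t ht => ?_⟩
  · refine IsControl.pVar_lt_top (v := fun t => (L : ℝ) ^ p * v t) ⟨?_, ?_⟩ hp0
    · exact fun s hs t ht hst => mul_le_mul_of_nonneg_left (hvY.mono hs ht hst) (by positivity)
    · intro s t hs hst ht
      rw [← mul_sub]
      calc _ ≤ (L * ‖Y t - Y s‖) ^ p := by gcongr; exact hΦY s t hs hst ht
        _ = (L : ℝ) ^ p * ‖Y t - Y s‖ ^ p := Real.mul_rpow L.2 (norm_nonneg _)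
        _ ≤ _ := by gcongr; exact hvY.rpow_le s t hs hst ht
  · have hex : ∀ i, ∃ I, IsYoungIntegral (fun s => toCLM (f (Φ (Y s)) (Pi.single i 1)))
        (fun s => X s i) 0 t I := by
      intro i
      refine exists_isYoungIntegral (v := v) (C := |C| * (L : ℝ) ^ γ) hp1 hγ1 hγp (by positivity)
        (continuousOn_pi.1 hX.1 i) ⟨hvX.mono, fun s t hs hst ht => ?_⟩ (fun s t hs hst ht => ?_) ht
      · refine le_trans ?_ (hvX.rpow_le s t hs hst ht)
        gcongr
        exact norm_le_pi_norm (X t - X s) i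
      · refine le_trans ?_ (hfΦ s t hs hst ht)
        have : toCLM (f (Φ (Y t)) (Pi.single i 1)) - toCLM (f (Φ (Y s)) (Pi.single i 1)) =
            toCLM ((f (Φ (Y t)) - f (Φ (Y s))) (Pi.single i 1)) := by
          ext
          simp [toCLM]
        rw [this, norm_toCLM]
        simpa [Pi.norm_single] using
          (f (Φ (Y t)) - f (Φ (Y s))).le_opNorm (Pi.single i (1 : ℝ))
    choose I hI using hex
    have := YoungPartition.neBot ht.1
    refine ⟨I, hI, ?_⟩
    rw [← tendsto_nhds_unique (hΦint t ht) (isYoungIntegral_sum_coord hI), hY0]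
    abel
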